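/- (Generating function.) Let ν, μ ∈ ℂ, x ∈ (-1,1), and s ∈ ℝ with |s| < 1. Then ∑_{n=0}^∞ (μ - ν)_n · P_{n-ν-1}^{-μ}(x) · s^n / n! = (1 - 2sx + s²)^{ν/2} · P_ν^{-μ}((x - s)/√(1 - 2sx + s²)), the series converging; note that 1 - 2sx + s² > 0 and (x-s)/√(1-2sx+s²) ∈ (-1,1) under these hypotheses. -/

import Mathlib

noncomputable def pochC (a : ℂ) (n : ℕ) : ℂ := (ascPochhammer ℂ n).eval a

/-- Ferrers function of the first kind `P_ν^μ(x)`. -/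
noncomputable def ferrersP (ν μ : ℂ) (x : ℝ) : ℂ :=
  (((1 + x) / (1 - x) : ℝ) : ℂ) ^ (μ / 2) *
    ∑' n : ℕ, pochC (-ν) n * pochC (ν + 1) n /
        (Complex.Gamma ((n : ℂ) + 1 - μ) * (n.factorial : ℂ)) *
      (((1 - x) / 2 : ℝ) : ℂ) ^ n

open Filter Topology Metric

lemma tendsto_natCast_add_div_natCast_add (a b : ℂ) :
    Tendsto (fun n : ℕ => ((n : ℂ) + a) / (n + b)) atTop (𝓝 1) := by
  have hinv : Tendsto (fun n : ℕ => ((n : ℂ))⁻¹) atTop (𝓝 0) := tendsto_inv_atTop_nhds_zero_nat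
  have h1 := ((hinv.const_mul a).const_add 1).div ((hinv.const_mul b).const_add 1) (by simp)
  rw [mul_zero, mul_zero, add_zero, div_one] at h1
  refine h1.congr' ?_
  filter_upwards [eventually_gt_atTop 0] with n hn
  have hn : (n : ℂ) ≠ 0 := by exact_mod_cast hn.ne'
  rw [Pi.div_apply, ← mul_div_mul_left _ _ hn]
  congr 1 <;> field_simp

lemma summable_of_recurrence_of_roots {a A B : ℕ → ℂ} {w v s : ℂ} (hw : ‖w‖ ≤ 1) (hv : ‖v‖ ≤ 1)
    (hwv : w ≠ v) (hs : ‖s‖ < 1) (hA : Tendsto A atTop (𝓝 (w + v)))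
    (hB : Tendsto B atTop (𝓝 (-(w * v))))
    (h : ∀ n, a (n + 2) = A n * a (n + 1) + B n * a n) :
    Summable fun n => a n * s ^ n := by
  set K : ℝ := ‖w - v‖⁻¹ with hK
  have hK0 : 0 ≤ K := by positivity
  have hne : w - v ≠ 0 := sub_ne_zero.2 hwv
  set M : ℕ → ℝ := fun n => ‖a (n + 1) - w * a n‖ + ‖a (n + 1) - v * a n‖ with hM
  have hM0 : ∀ n, 0 ≤ M n := fun n => by positivity
  have ha : ∀ n, ‖a n‖ ≤ K * M n := by
    intro n
    have e : a n = (w - v)⁻¹ * ((a (n + 1) - v * a n) - (a (n + 1) - w * a n)) := by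
      field_simp; ring
    calc ‖a n‖ = K * ‖(a (n + 1) - v * a n) - (a (n + 1) - w * a n)‖ := by
          conv_lhs => rw [e, norm_mul, norm_inv]
      _ ≤ K * M n := by
          gcongr
          exact (norm_sub_le _ _).trans (add_comm _ _).le
  have ha' : ∀ n, ‖a (n + 1)‖ ≤ K * M n := by
    intro n
    have e : a (n + 1) = (w - v)⁻¹ * (w * (a (n + 1) - v * a n) - v * (a (n + 1) - w * a n)) := by
      field_simp; ring
    calc ‖a (n + 1)‖ = K * ‖w * (a (n + 1) - v * a n) - v * (a (n + 1) - w * a n)‖ := by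
          conv_lhs => rw [e, norm_mul, norm_inv]
      _ ≤ K * M n := by
          gcongr
          refine (norm_sub_le _ _).trans ?_
          rw [norm_mul, norm_mul, hM, add_comm]
          exact add_le_add (mul_le_of_le_one_left (norm_nonneg _) hv)
            (mul_le_of_le_one_left (norm_nonneg _) hw)
  set η : ℕ → ℝ := fun n => 2 * (‖A n - (w + v)‖ + ‖B n - -(w * v)‖) * K with hη
  have hη0 : Tendsto (fun n => (1 + η n) * ‖s‖) atTop (𝓝 ‖s‖) := by
    have h1 := tendsto_iff_norm_sub_tendsto_zero.1 hA
    have h2 := tendsto_iff_norm_sub_tendsto_zero.1 hB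
    have := ((((h1.add h2).const_mul 2).mul_const K).const_add 1).mul_const ‖s‖
    rwa [add_zero, mul_zero, zero_mul, add_zero, one_mul] at this
  have key : ∀ p q : ℂ, ‖q‖ ≤ 1 → p + q = w + v → p * q = w * v → ∀ n,
      ‖a (n + 2) - p * a (n + 1)‖ ≤ ‖a (n + 1) - p * a n‖ + η n / 2 * M n := by
    intro p q hq hs hp n
    have e : a (n + 2) - p * a (n + 1) = q * (a (n + 1) - p * a n) +
        ((A n - (w + v)) * a (n + 1) + (B n - -(w * v)) * a n) := by
      rw [h, ← hs, ← hp]; ring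
    rw [e]
    refine (norm_add_le _ _).trans (add_le_add ?_ ((norm_add_le _ _).trans ?_))
    · rw [norm_mul]; exact mul_le_of_le_one_left (norm_nonneg _) hq
    · rw [norm_mul, norm_mul]
      calc _ ≤ ‖A n - (w + v)‖ * (K * M n) + ‖B n - -(w * v)‖ * (K * M n) := by
            gcongr
            exacts [ha' n, ha n]
        _ = _ := by rw [hη]; ring
  have hstep : ∀ n, M (n + 1) ≤ (1 + η n) * M n := by
    intro n
    have h1 := key w v hv rfl rfl n
    have h2 := key v w hw (add_comm _ _) (mul_comm _ _) n
    calc M (n + 1) ≤ _ := add_le_add h1 h2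
      _ = _ := by rw [hM]; ring
  obtain ⟨r, hsr, hr⟩ := exists_between hs
  have hsum : Summable fun n => M n * ‖s‖ ^ n := by
    refine summable_of_ratio_norm_eventually_le hr ?_
    filter_upwards [hη0.eventually_le_const hsr] with n hn
    rw [Real.norm_of_nonneg (by have := hM0 (n + 1); positivity),
      Real.norm_of_nonneg (by have := hM0 n; positivity)]
    calc M (n + 1) * ‖s‖ ^ (n + 1) ≤ (1 + η n) * M n * ‖s‖ ^ (n + 1) := by gcongr; exact hstep n
      _ = ((1 + η n) * ‖s‖) * (M n * ‖s‖ ^ n) := by ring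
      _ ≤ r * (M n * ‖s‖ ^ n) := by have := hM0 n; gcongr
  refine Summable.of_norm_bounded (hsum.mul_left K) fun n => ?_
  rw [norm_mul, norm_pow, ← mul_assoc]
  gcongr
  exact ha n

lemma summable_of_recurrence {a A B : ℕ → ℂ} {x : ℝ} {s : ℂ} (hx : -1 < x) (hx1 : x < 1)
    (hs : ‖s‖ < 1) (hA : Tendsto A atTop (𝓝 (2 * x))) (hB : Tendsto B atTop (𝓝 (-1)))
    (h : ∀ n, a (n + 2) = A n * a (n + 1) + B n * a n) :
    Summable fun n => a n * s ^ n := by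
  have hpos : 0 < 1 - x ^ 2 := by nlinarith
  set y := √(1 - x ^ 2) with hy
  have hy0 : 0 < y := Real.sqrt_pos.2 hpos
  have hyy : y ^ 2 = 1 - x ^ 2 := Real.sq_sqrt hpos.le
  have hyC : (y : ℂ) ^ 2 = 1 - (x : ℂ) ^ 2 := by exact_mod_cast hyy
  have hn1 : ‖(x : ℂ) + y * Complex.I‖ = 1 := by
    rw [Complex.norm_add_mul_I, hyy]; simp
  have hn2 : ‖(x : ℂ) - y * Complex.I‖ = 1 := by
    have := Complex.norm_add_mul_I x (-y)
    rw [neg_sq, hyy] at this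
    simpa [sub_eq_add_neg] using this
  refine summable_of_recurrence_of_roots (w := x + y * Complex.I) (v := x - y * Complex.I)
    hn1.le hn2.le ?_ hs ?_ ?_ h
  · intro e
    have := congrArg Complex.im e
    simp at this
    linarith
  · convert hA using 2; ring
  · convert hB using 2
    linear_combination (y : ℂ) ^ 2 * Complex.I_sq - hyC

lemma hasSum_powerSeries_deriv {c : ℕ → ℂ}
    (hc : ∀ r : ℝ, |r| < 1 → Summable fun n => c n * (r : ℂ) ^ n) {t : ℂ} (ht : ‖t‖ < 1) :
    DifferentiableAt ℂ (fun z => ∑' n, c n * z ^ n) t ∧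
      HasSum (fun n : ℕ => n * c n * t ^ n) (t * deriv (fun z => ∑' n, c n * z ^ n) t) := by
  obtain ⟨r, htr, hr⟩ := exists_between ht
  have hr0 : 0 ≤ r := (norm_nonneg t).trans htr.le
  have hu : Summable fun n => ‖c n * (r : ℂ) ^ n‖ := (hc r (by rwa [abs_of_nonneg hr0])).norm
  have hF : ∀ n, DifferentiableOn ℂ (fun z => c n * z ^ n) (ball 0 r) := fun n => by fun_prop
  have hle : ∀ n (w : ℂ), w ∈ ball 0 r → ‖c n * w ^ n‖ ≤ ‖c n * (r : ℂ) ^ n‖ := by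
    intro n w hw
    rw [mem_ball_zero_iff] at hw
    rw [norm_mul, norm_mul, norm_pow, norm_pow, Complex.norm_of_nonneg hr0]
    gcongr
  have hmem : t ∈ ball (0 : ℂ) r := by simpa using htr
  refine ⟨(Complex.differentiableOn_tsum_of_summable_norm hu hF isOpen_ball hle).differentiableAt
    (isOpen_ball.mem_nhds hmem), ?_⟩
  have := (Complex.hasSum_deriv_of_summable_norm hu hF isOpen_ball hle hmem).mul_left t
  refine this.congr_fun ?_
  intro n
  rcases n with _ | n
  · simp
  · simp; ring

lemma analyticAt_powerSeries_ofReal {c : ℕ → ℂ}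
    (hc : ∀ r : ℝ, |r| < 1 → Summable fun n => c n * (r : ℂ) ^ n) {t : ℝ} (ht : |t| < 1) :
    AnalyticAt ℝ (fun r : ℝ => ∑' n, c n * (r : ℂ) ^ n) t := by
  have h : AnalyticAt ℂ (fun z : ℂ => ∑' n, c n * z ^ n) (t : ℂ) := by
    refine DifferentiableOn.analyticAt (s := ball 0 1) (fun z hz => ?_) (isOpen_ball.mem_nhds ?_)
    · exact (hasSum_powerSeries_deriv hc (by simpa using hz)).1.differentiableWithinAt
    · simpa using ht
  exact h.restrictScalars.comp (Complex.ofRealCLM.analyticAt t)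

lemma HasDerivAt.ofReal_cpow_const_of_pos {g : ℝ → ℝ} {g' x : ℝ} (hg : HasDerivAt g g' x)
    (h : 0 < g x) (a : ℂ) :
    HasDerivAt (fun y => ((g y : ℝ) : ℂ) ^ a) (a * (g' / g x) * ((g x : ℝ) : ℂ) ^ a) x := by
  have hne : ((g x : ℝ) : ℂ) ≠ 0 := by exact_mod_cast h.ne'
  have hs : ((g x : ℝ) : ℂ) ∈ Complex.slitPlane := by simpa using h
  have := (((hasDerivAt_id _).cpow_const (c := a) hs).scomp x hg.ofReal_comp)
  refine this.congr_deriv ?_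
  change (g' : ℂ) * (a * (g x : ℂ) ^ (a - 1) * 1) = _
  rw [Complex.cpow_sub _ _ hne, Complex.cpow_one]
  field_simp

lemma AnalyticAt.ofReal_cpow_const {g : ℝ → ℝ} {x : ℝ} (hg : AnalyticAt ℝ g x) (h : 0 < g x)
    (a : ℂ) : AnalyticAt ℝ (fun y => ((g y : ℝ) : ℂ) ^ a) x := by
  have h1 : AnalyticAt ℂ (fun z : ℂ => z ^ a) (g x : ℂ) :=
    analyticAt_id.cpow analyticAt_const (by simpa using h)
  exact (h1.restrictScalars (𝕜 := ℝ)).comp_of_eq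
    ((Complex.ofRealCLM.analyticAt (g x)).comp hg) rfl

lemma AnalyticAt.real_sqrt {g : ℝ → ℝ} {x : ℝ} (hg : AnalyticAt ℝ g x) (h : 0 < g x) :
    AnalyticAt ℝ (fun y => √(g y)) x := by
  have h1 : AnalyticAt ℝ (fun y => Real.exp (Real.log (g y) / 2)) x :=
    ((hg.log h).div analyticAt_const two_ne_zero).rexp
  refine h1.congr ?_
  filter_upwards [hg.continuousAt.eventually (lt_mem_nhds h)] with y hy
  rw [Real.exp_half, Real.exp_log hy]

lemma pochC_zero (a : ℂ) : pochC a 0 = 1 := by simp [pochC]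

lemma pochC_succ (a : ℂ) (n : ℕ) : pochC a (n + 1) = pochC a n * (a + n) :=
  ascPochhammer_succ_eval n a

lemma pochC_succ' (a : ℂ) (n : ℕ) : pochC a (n + 1) = a * pochC (a + 1) n := by
  simp [pochC, ascPochhammer_succ_left, Polynomial.eval_comp]

/-- The coefficients of the hypergeometric factor of `ferrersP`. -/
noncomputable def ferrersCoeff (ν μ : ℂ) (n : ℕ) : ℂ :=
  pochC (-ν) n * pochC (ν + 1) n / (Complex.Gamma ((n : ℂ) + 1 - μ) * (n.factorial : ℂ))

lemma ferrersP_eq (ν μ : ℂ) (x : ℝ) : ferrersP ν μ x =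
    (((1 + x) / (1 - x) : ℝ) : ℂ) ^ (μ / 2) *
      ∑' n : ℕ, ferrersCoeff ν μ n * (((1 - x) / 2 : ℝ) : ℂ) ^ n := rfl

lemma ferrersP_neg_sub_one (ν μ : ℂ) (x : ℝ) : ferrersP (-ν - 1) μ x = ferrersP ν μ x := by
  simp only [ferrersP]
  congr! 5 with n
  rw [show -(-ν - 1) = ν + 1 by ring, show -ν - 1 + 1 = -ν by ring, mul_comm]

lemma ferrersCoeff_succ_mul (ν μ : ℂ) (n : ℕ) :
    ferrersCoeff ν μ (n + 1) * ((n + 1 - μ) * (n + 1)) =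
      ferrersCoeff ν μ n * ((n - ν) * (n + ν + 1)) := by
  have hn : (n : ℂ) + 1 ≠ 0 := by exact_mod_cast n.succ_ne_zero
  have hf : (n.factorial : ℂ) ≠ 0 := by exact_mod_cast n.factorial_ne_zero
  have hg := Complex.one_div_Gamma_eq_self_mul_one_div_Gamma_add_one ((n : ℂ) + 1 - μ)
  simp only [ferrersCoeff, pochC_succ, Nat.factorial_succ, Nat.cast_mul, Nat.cast_succ,
    div_eq_mul_inv, mul_inv]
  rw [hg, show (n : ℂ) + 1 - μ + 1 = n + 1 + 1 - μ by ring]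
  field_simp
  ring

lemma summable_ferrersCoeff (ν μ : ℂ) {t : ℂ} (ht : ‖t‖ < 1) :
    Summable fun n => ferrersCoeff ν μ n * t ^ n := by
  obtain ⟨r, htr, hr⟩ := exists_between ht
  have hlim : Tendsto (fun n : ℕ => ((n : ℂ) - ν) * (n + ν + 1) / ((n + 1 - μ) * (n + 1)) * t)
      atTop (𝓝 t) := by
    have := ((tendsto_natCast_add_div_natCast_add (-ν) (1 - μ)).mul
      (tendsto_natCast_add_div_natCast_add (ν + 1) 1)).mul_const t
    rw [one_mul, one_mul] at this
    refine this.congr fun n => ?_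
    rw [div_mul_div_comm]
    ring
  refine summable_of_ratio_norm_eventually_le hr ?_
  filter_upwards [hlim.norm.eventually_le_const htr, eventually_gt_atTop ⌈‖μ‖⌉₊] with n hn hnμ
  have h1 : (n : ℂ) + 1 ≠ 0 := by exact_mod_cast n.succ_ne_zero
  have h2 : (n : ℂ) + 1 - μ ≠ 0 := by
    intro h0
    have h3 : μ = ((n + 1 : ℕ) : ℂ) := by push_cast; linear_combination -h0
    have h4 := Nat.lt_of_ceil_lt hnμ
    rw [h3, Complex.norm_natCast] at h4
    push_cast at h4
    linarith
  have e : ferrersCoeff ν μ (n + 1) * t ^ (n + 1) =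
      (((n : ℂ) - ν) * (n + ν + 1) / ((n + 1 - μ) * (n + 1)) * t) *
        (ferrersCoeff ν μ n * t ^ n) := by
    rw [eq_div_of_mul_eq (mul_ne_zero h2 h1) (ferrersCoeff_succ_mul ν μ n)]
    ring
  rw [e, norm_mul]
  gcongr

lemma ferrersCoeff_contiguous_succ (ν μ : ℂ) (n : ℕ) :
    (ν + μ) * ferrersCoeff ν μ (n + 1) - 2 * ((n + 1 : ℕ) : ℂ) * ferrersCoeff ν μ (n + 1)
      + 2 * (n - ν) * ferrersCoeff ν μ n = (ν + μ) * ferrersCoeff (ν - 1) μ (n + 1) := by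
  have hn : (n : ℂ) + 1 ≠ 0 := by exact_mod_cast n.succ_ne_zero
  have hf : (n.factorial : ℂ) ≠ 0 := by exact_mod_cast n.factorial_ne_zero
  have hg := Complex.one_div_Gamma_eq_self_mul_one_div_Gamma_add_one ((n : ℂ) + 1 - μ)
  have h1 : (n - ν) * pochC (-ν) n = -ν * pochC (1 - ν) n := by
    rw [show (1 : ℂ) - ν = -ν + 1 by ring, ← pochC_succ', pochC_succ]; ring
  have h2 : pochC (-(ν - 1)) (n + 1) = pochC (1 - ν) n * (1 - ν + n) := by
    rw [neg_sub, pochC_succ]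
  have h3 : pochC (ν - 1 + 1) (n + 1) = ν * pochC (ν + 1) n := by
    rw [sub_add_cancel, pochC_succ']
  have h4 : pochC (-ν) (n + 1) = -ν * pochC (1 - ν) n := by
    rw [pochC_succ', neg_add_eq_sub]
  have h5 : ferrersCoeff ν μ n * (n - ν) = -ν * pochC (1 - ν) n * pochC (ν + 1) n *
      ((n + 1 - μ) * (Complex.Gamma (n + 1 + 1 - μ))⁻¹) * (n.factorial : ℂ)⁻¹ := by
    rw [show (n : ℂ) + 1 + 1 - μ = n + 1 - μ + 1 by ring, ← hg, ← h1, ferrersCoeff,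
      div_eq_mul_inv, mul_inv]
    ring
  rw [show 2 * ((n : ℂ) - ν) * ferrersCoeff ν μ n = 2 * (ferrersCoeff ν μ n * (n - ν)) by ring, h5]
  simp only [ferrersCoeff, h2, h3, h4, pochC_succ (ν + 1), Nat.factorial_succ, Nat.cast_mul,
    Nat.cast_succ, div_eq_mul_inv, mul_inv]
  field_simp
  ring

lemma ferrersCoeff_contiguous_zero (ν μ : ℂ) :
    (ν + μ) * ferrersCoeff ν μ 0 = (ν + μ) * ferrersCoeff (ν - 1) μ 0 := by
  simp [ferrersCoeff, pochC_zero]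

/-- The hypergeometric factor of `ferrersP`. -/
noncomputable def ferrersSeries (ν μ t : ℂ) : ℂ := ∑' n : ℕ, ferrersCoeff ν μ n * t ^ n

lemma ferrersSeries_contiguous (ν μ : ℂ) {t : ℂ} (ht : ‖t‖ < 1) :
    μ * ferrersSeries ν μ t - 2 * t * (1 - t) * deriv (ferrersSeries ν μ) t =
      (ν + μ) * ferrersSeries (ν - 1) μ t - ν * (1 - 2 * t) * ferrersSeries ν μ t := by
  have hr : ∀ r : ℝ, |r| < 1 → Summable fun n => ferrersCoeff ν μ n * (r : ℂ) ^ n :=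
    fun r h => summable_ferrersCoeff ν μ (by simpa using h)
  have h0 : HasSum (fun n => ferrersCoeff ν μ n * t ^ n) (ferrersSeries ν μ t) :=
    (summable_ferrersCoeff ν μ ht).hasSum
  have h1 : HasSum (fun n => ferrersCoeff (ν - 1) μ n * t ^ n) (ferrersSeries (ν - 1) μ t) :=
    (summable_ferrersCoeff (ν - 1) μ ht).hasSum
  have hd : HasSum (fun n : ℕ => n * ferrersCoeff ν μ n * t ^ n)
      (t * deriv (ferrersSeries ν μ) t) := (hasSum_powerSeries_deriv hr ht).2
  have hshift : HasSum (fun n : ℕ => 2 * (n - ν) * ferrersCoeff ν μ n * t ^ (n + 1))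
      (2 * t * (t * deriv (ferrersSeries ν μ) t - ν * ferrersSeries ν μ t)) := by
    refine ((hd.sub (h0.mul_left ν)).mul_left (2 * t)).congr_fun fun n => ?_
    ring
  have hrest : HasSum (fun n : ℕ => (ν + μ) * (ferrersCoeff (ν - 1) μ n * t ^ n) -
      ((ν + μ) * (ferrersCoeff ν μ n * t ^ n) - 2 * (n * ferrersCoeff ν μ n * t ^ n)))
      ((ν + μ) * ferrersSeries (ν - 1) μ t - ((ν + μ) * ferrersSeries ν μ t -
        2 * (t * deriv (ferrersSeries ν μ) t))) :=
    (h1.mul_left _).sub ((h0.mul_left _).sub (hd.mul_left 2))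
  have hshift' := (hasSum_nat_add_iff' 1).2 hrest
  have e := hshift.unique (hshift'.congr_fun fun n => by
    have := ferrersCoeff_contiguous_succ ν μ n
    linear_combination t ^ (n + 1) * this)
  rw [Finset.sum_range_one] at e
  have e0 := ferrersCoeff_contiguous_zero ν μ
  linear_combination e + e0

lemma abs_one_sub_div_two_lt {x : ℝ} (hx : -1 < x) (hx1 : x < 1) : |(1 - x) / 2| < 1 :=
  abs_lt.2 ⟨by linarith, by linarith⟩

lemma hasDerivAt_ferrersP (ν μ : ℂ) {x : ℝ} (hx : -1 < x) (hx1 : x < 1) :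
    HasDerivAt (ferrersP ν μ)
      (((ν + μ) * ferrersP (ν - 1) μ x - ν * x * ferrersP ν μ x) / (1 - x ^ 2)) x := by
  have h1 : 1 - x ≠ 0 := by linarith
  have h2 : 1 + x ≠ 0 := by linarith
  have hpos : 0 < (1 + x) / (1 - x) := div_pos (by linarith) (by linarith)
  have ht : ‖(((1 - x) / 2 : ℝ) : ℂ)‖ < 1 := by
    rw [Complex.norm_real]
    exact abs_one_sub_div_two_lt hx hx1
  have hw : HasDerivAt (fun y : ℝ => (1 + y) / (1 - y)) (2 / (1 - x) ^ 2) x := by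
    refine (((hasDerivAt_id x).const_add 1).div ((hasDerivAt_id x).const_sub 1) h1).congr_deriv ?_
    simp only [id]
    ring
  have hlin : HasDerivAt (fun y : ℝ => (1 - y) / 2) (-1 / 2) x :=
    ((hasDerivAt_id x).const_sub 1).div_const 2
  have hser : HasDerivAt (ferrersSeries ν μ) (deriv (ferrersSeries ν μ) (((1 - x) / 2 : ℝ) : ℂ))
      (((1 - x) / 2 : ℝ) : ℂ) :=
    (hasSum_powerSeries_deriv
      (fun r h => summable_ferrersCoeff ν μ (by simpa using h)) ht).1.hasDerivAt
  have hprod := (hw.ofReal_cpow_const_of_pos hpos (μ / 2)).mul (hser.scomp x hlin.ofReal_comp)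
  refine HasDerivAt.congr_deriv hprod ?_
  have hc := ferrersSeries_contiguous ν μ ht
  have h1c : (1 : ℂ) - x ≠ 0 := by exact_mod_cast h1
  have h2c : (1 : ℂ) + x ≠ 0 := by exact_mod_cast h2
  have h3c : (1 : ℂ) - x ^ 2 ≠ 0 := by
    rw [show (1 : ℂ) - x ^ 2 = (1 - x) * (1 + x) by ring]
    exact mul_ne_zero h1c h2c
  rw [eq_div_iff h3c, ferrersP_eq, ferrersP_eq]
  change _ = (ν + μ) * (_ * ferrersSeries (ν - 1) μ _) - ν * x * (_ * ferrersSeries ν μ _)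
  simp only [Function.comp_apply, smul_eq_mul]
  set W : ℂ := (((1 + x) / (1 - x) : ℝ) : ℂ) ^ (μ / 2)
  set D := deriv (ferrersSeries ν μ) (((1 - x) / 2 : ℝ) : ℂ)
  set H := ferrersSeries ν μ (((1 - x) / 2 : ℝ) : ℂ)
  set H' := ferrersSeries (ν - 1) μ (((1 - x) / 2 : ℝ) : ℂ)
  have e : ((2 / (1 - x) ^ 2 : ℝ) : ℂ) / (((1 + x) / (1 - x) : ℝ) : ℂ) * (1 - x ^ 2) = 2 := by
    push_cast
    field_simp
    ring
  push_cast at hc e ⊢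
  linear_combination W * hc + (μ / 2) * W * H * e

lemma ferrersP_recurrence (ν μ : ℂ) {x : ℝ} (hx : -1 < x) (hx1 : x < 1) :
    (ν + μ) * ferrersP (ν - 1) μ x =
      (2 * ν + 1) * x * ferrersP ν μ x + (μ - ν - 1) * ferrersP (ν + 1) μ x := by
  have h := hasDerivAt_ferrersP ν μ hx hx1
  have h' := hasDerivAt_ferrersP (-ν - 1) μ hx hx1
  have hfun : ferrersP (-ν - 1) μ = ferrersP ν μ := funext (ferrersP_neg_sub_one ν μ)
  have hne : (1 : ℂ) - x ^ 2 ≠ 0 := by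
    have : (1 : ℝ) - x ^ 2 ≠ 0 := by nlinarith
    exact_mod_cast this
  rw [hfun, show -ν - 1 - 1 = -(ν + 1) - 1 by ring, ferrersP_neg_sub_one] at h'
  have e := h.unique h'
  rw [div_left_inj' hne] at e
  linear_combination e

lemma analyticAt_ferrersP (ν μ : ℂ) {x : ℝ} (hx : -1 < x) (hx1 : x < 1) :
    AnalyticAt ℝ (ferrersP ν μ) x := by
  have h1 : 1 - x ≠ 0 := by linarith
  have hpos : 0 < (1 + x) / (1 - x) := div_pos (by linarith) (by linarith)
  have hw : AnalyticAt ℝ (fun y : ℝ => (1 + y) / (1 - y)) x := by fun_prop (disch := assumption)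
  have hlin : AnalyticAt ℝ (fun y : ℝ => (1 - y) / 2) x := by fun_prop (disch := norm_num)
  refine (hw.ofReal_cpow_const hpos (μ / 2)).mul ?_
  exact (analyticAt_powerSeries_ofReal (fun r h => summable_ferrersCoeff ν μ (by simpa using h))
    (abs_one_sub_div_two_lt hx hx1)).comp_of_eq hlin rfl

lemma summable_ferrersP_mul_pow (ν μ : ℂ) {x : ℝ} {s : ℂ} (hx : -1 < x) (hx1 : x < 1)
    (hs : ‖s‖ < 1) :
    Summable fun n : ℕ => pochC (-μ - ν) n * ferrersP (ν - n) μ x / n.factorial * s ^ n := by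
  refine summable_of_recurrence (x := x) hx hx1 hs
    (A := fun n : ℕ => 2 * x * ((n + (1 / 2 - ν)) / (n + 2)))
    (B := fun n : ℕ => -((n + (μ - ν)) / (n + 1) * ((n + (-μ - ν)) / (n + 2)))) ?_ ?_ fun n => ?_
  · simpa using (tendsto_natCast_add_div_natCast_add (1 / 2 - ν) 2).const_mul (2 * (x : ℂ))
  · simpa using ((tendsto_natCast_add_div_natCast_add (μ - ν) 1).mul
      (tendsto_natCast_add_div_natCast_add (-μ - ν) 2)).neg
  · have hf : (n.factorial : ℂ) ≠ 0 := by exact_mod_cast n.factorial_ne_zero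
    have hn1 : (n : ℂ) + 1 ≠ 0 := by exact_mod_cast n.succ_ne_zero
    have hn2 : (n : ℂ) + 2 ≠ 0 := by exact_mod_cast (n + 1).succ_ne_zero
    have hr := ferrersP_recurrence (ν - (n + 1 : ℕ)) μ hx hx1
    have e1 : ν - ((n + 1 : ℕ) : ℂ) - 1 = ν - ((n + 2 : ℕ) : ℂ) := by push_cast; ring
    have e2 : ν - ((n + 1 : ℕ) : ℂ) + 1 = ν - (n : ℂ) := by push_cast; ring
    rw [e1, e2] at hr
    rw [pochC_succ _ (n + 1), pochC_succ _ n, Nat.factorial_succ (n + 1), Nat.factorial_succ n]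
    set P := ferrersP (ν - (n : ℂ)) μ x
    set Q := ferrersP (ν - ((n + 1 : ℕ) : ℂ)) μ x
    set R := ferrersP (ν - ((n + 2 : ℕ) : ℂ)) μ x
    push_cast at hr ⊢
    rw [show (n : ℂ) + 1 + 1 = n + 2 by ring]
    field_simp
    linear_combination -(-μ - ν + n) * pochC (-μ - ν) n * hr

lemma one_sub_two_mul_add_sq_pos {x : ℝ} (hx : -1 < x) (hx1 : x < 1) (s : ℝ) :
    0 < 1 - 2 * s * x + s ^ 2 := by
  nlinarith [sq_nonneg (s - x), mul_pos (by linarith : 0 < 1 - x) (by linarith : 0 < 1 + x)]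

lemma abs_sub_div_sqrt_lt_one {x : ℝ} (hx : -1 < x) (hx1 : x < 1) (s : ℝ) :
    |(x - s) / √(1 - 2 * s * x + s ^ 2)| < 1 := by
  have hq := one_sub_two_mul_add_sq_pos hx hx1 s
  rw [← sq_lt_one_iff_abs_lt_one, div_pow, Real.sq_sqrt hq.le, div_lt_one hq]
  nlinarith

/-- The closed form of the generating function. -/
noncomputable def ferrersGen (ν μ : ℂ) (x s : ℝ) : ℂ :=
  ((1 - 2 * s * x + s ^ 2 : ℝ) : ℂ) ^ (ν / 2) *
    ferrersP ν μ ((x - s) / √(1 - 2 * s * x + s ^ 2))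

lemma analyticAt_ferrersGen (ν μ : ℂ) {x : ℝ} (hx : -1 < x) (hx1 : x < 1) (s : ℝ) :
    AnalyticAt ℝ (ferrersGen ν μ x) s := by
  have hq := one_sub_two_mul_add_sq_pos hx hx1 s
  obtain ⟨hz, hz1⟩ := abs_lt.1 (abs_sub_div_sqrt_lt_one hx hx1 s)
  have hqa : AnalyticAt ℝ (fun s : ℝ => 1 - 2 * s * x + s ^ 2) s := by fun_prop
  have hza : AnalyticAt ℝ (fun s : ℝ => (x - s) / √(1 - 2 * s * x + s ^ 2)) s :=
    (analyticAt_const.sub analyticAt_id).div (hqa.real_sqrt hq) (Real.sqrt_pos.2 hq).ne'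
  exact (hqa.ofReal_cpow_const hq (ν / 2)).mul
    ((analyticAt_ferrersP ν μ hz hz1).comp_of_eq hza rfl)

lemma hasDerivAt_ferrersGen (ν μ : ℂ) {x : ℝ} (hx : -1 < x) (hx1 : x < 1) (s : ℝ) :
    HasDerivAt (ferrersGen ν μ x) ((-μ - ν) * ferrersGen (ν - 1) μ x s) s := by
  have hq := one_sub_two_mul_add_sq_pos hx hx1 s
  obtain ⟨hz, hz1⟩ := abs_lt.1 (abs_sub_div_sqrt_lt_one hx hx1 s)
  have hqd : HasDerivAt (fun s : ℝ => 1 - 2 * s * x + s ^ 2) (2 * (s - x)) s := by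
    refine (((((hasDerivAt_id s).const_mul 2).mul_const x).const_sub 1).add
      ((hasDerivAt_id s).pow 2)).congr_deriv ?_
    simp only [id]
    push_cast
    ring
  have hr0 : √(1 - 2 * s * x + s ^ 2) ≠ 0 := (Real.sqrt_pos.2 hq).ne'
  have hrr : √(1 - 2 * s * x + s ^ 2) ^ 2 = 1 - 2 * s * x + s ^ 2 := Real.sq_sqrt hq.le
  set r := √(1 - 2 * s * x + s ^ 2) with hr
  have hzd : HasDerivAt (fun s : ℝ => (x - s) / √(1 - 2 * s * x + s ^ 2))
      ((((x - s) / r) ^ 2 - 1) / r) s := by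
    refine (((hasDerivAt_id s).const_sub x).div (hqd.sqrt hq.ne') hr0).congr_deriv ?_
    simp only [id, ← hr]
    field_simp
    ring
  have hP := HasDerivAt.scomp s (hasDerivAt_ferrersP ν μ hz hz1) hzd
  refine ((hqd.ofReal_cpow_const_of_pos hq (ν / 2)).mul hP).congr_deriv ?_
  have hqc : ((1 - 2 * s * x + s ^ 2 : ℝ) : ℂ) ≠ 0 := by exact_mod_cast hq.ne'
  have hpow : ((1 - 2 * s * x + s ^ 2 : ℝ) : ℂ) ^ ((ν - 1) / 2) =
      ((1 - 2 * s * x + s ^ 2 : ℝ) : ℂ) ^ (ν / 2) / (√(1 - 2 * s * x + s ^ 2) : ℝ) := by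
    rw [sub_div, Complex.cpow_sub _ _ hqc, Real.sqrt_eq_rpow, Complex.ofReal_cpow hq.le]
    norm_num
  have hr0c : (r : ℂ) ≠ 0 := by exact_mod_cast hr0
  have hrrc : ((1 - 2 * s * x + s ^ 2 : ℝ) : ℂ) = (r : ℂ) ^ 2 := by exact_mod_cast hrr.symm
  have hzne : (1 : ℂ) - (((x - s) / r : ℝ) : ℂ) ^ 2 ≠ 0 := by
    have : 1 - ((x - s) / r) ^ 2 ≠ 0 := by nlinarith
    exact_mod_cast this
  rw [ferrersGen, hpow]
  simp only [Function.comp_apply, Complex.real_smul, ← hr]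
  set z := (x - s) / r with hzdef
  have hzr : ((2 * (s - x) : ℝ) : ℂ) = -2 * z * r := by
    rw [hzdef]; push_cast; field_simp; ring
  have hz2 : ((((z ^ 2 - 1) / r : ℝ)) : ℂ) = -(1 - (z : ℂ) ^ 2) / r := by push_cast; ring
  rw [hzr, hz2, hrrc]
  field_simp
  ring

lemma iteratedDeriv_ferrersGen (ν μ : ℂ) {x : ℝ} (hx : -1 < x) (hx1 : x < 1) (n : ℕ) :
    iteratedDeriv n (ferrersGen ν μ x) = fun s => pochC (-μ - ν) n * ferrersGen (ν - n) μ x s := by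
  induction n with
  | zero => simp [pochC_zero]
  | succ n ih =>
    rw [iteratedDeriv_succ, ih]
    ext s
    rw [((hasDerivAt_ferrersGen (ν - n) μ hx hx1 s).const_mul _).deriv, pochC_succ,
      show ν - ((n + 1 : ℕ) : ℂ) = ν - n - 1 by push_cast; ring]
    ring

lemma ferrersGen_zero (ν μ : ℂ) (x : ℝ) : ferrersGen ν μ x 0 = ferrersP ν μ x := by
  simp [ferrersGen]

lemma eventually_hasSum_ferrersGen (ν μ : ℂ) {x : ℝ} (hx : -1 < x) (hx1 : x < 1) :
    ∀ᶠ s : ℝ in 𝓝 0, HasSum (fun n : ℕ => pochC (-μ - ν) n * ferrersP (ν - n) μ x /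
      n.factorial * (s : ℂ) ^ n) (ferrersGen ν μ x s) := by
  obtain ⟨p, r, hp⟩ := analyticAt_ferrersGen ν μ hx hx1 0
  filter_upwards [Metric.eball_mem_nhds 0 hp.r_pos] with s hs
  have h := hp.hasSum_iteratedFDeriv hs
  rw [zero_add] at h
  refine h.congr_fun fun n => ?_
  rw [iteratedFDeriv_apply_eq_iteratedDeriv_mul_prod, iteratedDeriv_ferrersGen ν μ hx hx1]
  simp [ferrersGen_zero]
  ring

lemma hasSum_ferrersGen (ν μ : ℂ) {x s : ℝ} (hx : -1 < x) (hx1 : x < 1) (hs : |s| < 1) :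
    HasSum (fun n : ℕ => pochC (-μ - ν) n * ferrersP (ν - n) μ x / n.factorial * (s : ℂ) ^ n)
      (ferrersGen ν μ x s) := by
  have hsum : ∀ r : ℝ, |r| < 1 → Summable fun n : ℕ =>
      pochC (-μ - ν) n * ferrersP (ν - n) μ x / n.factorial * (r : ℂ) ^ n :=
    fun r hr => summable_ferrersP_mul_pow ν μ hx hx1 (by simpa using hr)
  have heq : Set.EqOn (fun r : ℝ => ∑' n : ℕ,
      pochC (-μ - ν) n * ferrersP (ν - n) μ x / n.factorial * (r : ℂ) ^ n)
      (ferrersGen ν μ x) (ball 0 1) := by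
    refine AnalyticOnNhd.eqOn_of_preconnected_of_eventuallyEq (𝕜 := ℝ) (z₀ := 0)
      (fun r hr => analyticAt_powerSeries_ofReal hsum (by simpa using hr))
      (fun r _ => analyticAt_ferrersGen ν μ hx hx1 r) (convex_ball 0 1).isPreconnected (by simp) ?_
    filter_upwards [eventually_hasSum_ferrersGen ν μ hx hx1] with r hr using hr.tsum_eq
  rw [← heq (by simpa using hs)]
  exact (hsum s hs).hasSum

theorem stmt14 (ν μ : ℂ) (x s : ℝ) (hx : -1 < x) (hx1 : x < 1) (hs : |s| < 1) :
    HasSum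
      (fun n : ℕ => pochC (μ - ν) n * ferrersP ((n : ℂ) - ν - 1) (-μ) x *
        (s : ℂ) ^ n / (n.factorial : ℂ))
      (((1 - 2 * s * x + s ^ 2 : ℝ) : ℂ) ^ (ν / 2) *
        ferrersP ν (-μ) ((x - s) / Real.sqrt (1 - 2 * s * x + s ^ 2))) := by
  refine (hasSum_ferrersGen ν (-μ) hx hx1 hs).congr_fun fun n => ?_
  rw [neg_neg, ← ferrersP_neg_sub_one (ν - n), show -(ν - (n : ℂ)) - 1 = n - ν - 1 by ring]
  ring
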